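/- arXiv:2107.10706 — 2 statements merged into one kernel-verified Lean document; each statement's English description precedes it below -/
import Mathlib

section
/- Let H be a real inner product space, Z ⊆ H a nonempty convex set, μ > 0, δ > 0, and F, F₁ : H → H maps such that: ⟨F z₁ − F z₂, z₁ − z₂⟩ ≥ μ‖z₁ − z₂‖² for all z₁, z₂ ∈ Z; ‖(F z₁ − F₁ z₁) − (F z₂ − F₁ z₂)‖ ≤ δ‖z₁ − z₂‖ for all z₁, z₂ ∈ H; and z* ∈ Z satisfies ⟨F z*, ζ − z*⟩ ≥ 0 for all ζ ∈ Z. Set γ = min{1/(12μ), 1/(4δ)} and ẽ = 1/(2(2 + 4γδ²/μ + 4/(γμ) + 4γ²δ²)). Let z⁰ ∈ Z and suppose that for every k ≥ 0 the iterates satisfy: v^k = z^k − γ(F z^k − F₁ z^k); û^k ∈ Z with ⟨γ F₁ û^k + û^k − v^k, û^k − ζ⟩ ≤ 0 for all ζ ∈ Z; u^k ∈ H with ‖u^k − û^k‖² ≤ ẽ·‖z^k − û^k‖²; w^k = u^k + γ(F z^k − F₁ z^k − F u^k + F₁ u^k); and z^{k+1} ∈ Z with ⟨w^k − z^{k+1},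 ζ − z^{k+1}⟩ ≤ 0 for all ζ ∈ Z. Then for every ε with 0 < ε ≤ ‖z⁰ − z*‖² and every natural number K ≥ (1/(γμ))·ln(‖z⁰ − z*‖²/ε), one has ‖z^K − z*‖² ≤ ε. -/
open RealInnerProductSpace

/-- The scalar inequality behind one step of the method: `a = ‖û - z*‖`, `b = ‖z - û‖`,
`e = ‖u - û‖`, `m = γ * μ` and `d = γ * δ`. -/
lemma step_scalar_bound {m d a b e : ℝ} (hm : 0 < m) (hm' : m ≤ 1 / 12) (hd : 0 ≤ d)
    (hd' : d ≤ 1 / 4) (he : 8 * (1 + d ^ 2) * e ^ 2 ≤ m * b ^ 2) :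
    2 * ((1 + d) * e * a) - 2 * m * a ^ 2 + ((1 + d) * e + d * b) ^ 2 - b ^ 2
      ≤ -(m * (a + b) ^ 2) := by
  have hsq : ((1 + d) * e) ^ 2 ≤ m * b ^ 2 / 4 := by
    nlinarith [mul_nonneg (sq_nonneg (1 - d)) (sq_nonneg e)]
  have hcross : 2 * ((1 + d) * e * a) ≤ m / 2 * a ^ 2 + b ^ 2 / 2 := by
    have h : m * (2 * ((1 + d) * e * a)) ≤ m * (m / 2 * a ^ 2 + b ^ 2 / 2) := by
      nlinarith [sq_nonneg (m * a - 2 * ((1 + d) * e))]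
    exact le_of_mul_le_mul_left h hm
  have hmb : m * b ^ 2 ≤ b ^ 2 / 12 := by nlinarith [sq_nonneg b]
  have hdb : (d * b) ^ 2 ≤ b ^ 2 / 16 := by
    have : d ^ 2 ≤ 1 / 16 := by nlinarith
    nlinarith [sq_nonneg b]
  have hsum : ((1 + d) * e + d * b) ^ 2 ≤ 2 * ((1 + d) * e) ^ 2 + 2 * (d * b) ^ 2 := by
    nlinarith [sq_nonneg ((1 + d) * e - d * b)]
  have hab : m * (a + b) ^ 2 ≤ m * (3 / 2 * a ^ 2 + 3 * b ^ 2) := by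
    apply mul_le_mul_of_nonneg_left _ hm.le
    nlinarith [sq_nonneg (a - 2 * b)]
  nlinarith [sq_nonneg b]

/-- The projection onto a set containing `s` does not increase the distance to `s`. -/
lemma norm_sub_sq_le_of_projection {H : Type*} [NormedAddCommGroup H] [InnerProductSpace ℝ H]
    {w p s : H} (h : ⟪w - p, s - p⟫ ≤ 0) : ‖p - s‖ ^ 2 ≤ ‖w - s‖ ^ 2 := by
  have hexp : ‖w - s‖ ^ 2 = ‖w - p‖ ^ 2 - 2 * ⟪w - p, s - p⟫ + ‖s - p‖ ^ 2 := by
    rw [← norm_sub_sq_real]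
    congr 2
    abel
  rw [norm_sub_rev p s]
  nlinarith [sq_nonneg ‖w - p‖]

/-- One inexact step, with `D = F - F₁`, contracts the squared distance to the solution `s` by the
factor `1 - γ * μ`. -/
lemma step_contraction {H : Type*} [NormedAddCommGroup H] [InnerProductSpace ℝ H]
    {D : H → H} {μ δ γ : ℝ} {f z t u s p : H} (hγ : 0 < γ) (hμ : 0 < μ) (hδ : 0 < δ)
    (hγμ : γ * μ ≤ 1 / 12) (hγδ : γ * δ ≤ 1 / 4)
    (hlip : ∀ x y : H, ‖D x - D y‖ ≤ δ * ‖x - y‖)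
    (hf : μ * ‖t - s‖ ^ 2 ≤ ⟪f, t - s⟫)
    (ht : ⟪γ • (f - D t) + t - (z - γ • D z), t - s⟫ ≤ 0)
    (hu : 8 * (1 + (γ * δ) ^ 2) * ‖u - t‖ ^ 2 ≤ γ * μ * ‖z - t‖ ^ 2)
    (hp : ⟪u + γ • (D z - D u) - p, s - p⟫ ≤ 0) :
    ‖p - s‖ ^ 2 ≤ (1 - γ * μ) * ‖z - s‖ ^ 2 := by
  have hproj := norm_sub_sq_le_of_projection hp
  set w := u + γ • (D z - D u) with hw
  have hsmul : ∀ x y : H, ‖γ • (D x - D y)‖ ≤ γ * δ * ‖x - y‖ := fun x y => by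
    rw [norm_smul, Real.norm_of_nonneg hγ.le, mul_assoc]
    exact mul_le_mul_of_nonneg_left (hlip x y) hγ.le
  have hexp : ‖w - s‖ ^ 2
      = ‖z - s‖ ^ 2 + 2 * ⟪w - z, t - s⟫ + ‖w - t‖ ^ 2 - ‖z - t‖ ^ 2 := by
    have h₁ : w - s = (w - t) + (t - s) := by abel
    have h₂ : z - s = (z - t) + (t - s) := by abel
    have h₃ : w - z = (w - t) - (z - t) := by abel
    rw [h₁, h₂, h₃, norm_add_sq_real, norm_add_sq_real, inner_sub_left (w - t)]
    ring
  have hsplit : w - z = (γ • (f - D t) + t - (z - γ • D z))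
      + ((u - t) - γ • (D u - D t)) - γ • f := by
    rw [hw]
    module
  have herr : ⟪(u - t) - γ • (D u - D t), t - s⟫
      ≤ (1 + γ * δ) * ‖u - t‖ * ‖t - s‖ := by
    refine (real_inner_le_norm _ _).trans (mul_le_mul_of_nonneg_right ?_ (norm_nonneg _))
    linarith [norm_sub_le (u - t) (γ • (D u - D t)), hsmul u t]
  have hinner : ⟪w - z, t - s⟫
      ≤ (1 + γ * δ) * ‖u - t‖ * ‖t - s‖ - γ * μ * ‖t - s‖ ^ 2 := by
    rw [hsplit, inner_sub_left, inner_add_left, real_inner_smul_left]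
    linarith [mul_le_mul_of_nonneg_left hf hγ.le]
  have hd : 0 ≤ γ * δ := by positivity
  have hwt : ‖w - t‖ ≤ (1 + γ * δ) * ‖u - t‖ + γ * δ * ‖z - t‖ := by
    have h₁ : w - t = (u - t) + γ • (D z - D u) := by rw [hw]; abel
    have h₂ : ‖z - u‖ ≤ ‖z - t‖ + ‖u - t‖ := by
      simpa [norm_sub_rev t u] using norm_sub_le_norm_sub_add_norm_sub z t u
    rw [h₁]
    linarith [norm_add_le (u - t) (γ • (D z - D u)), hsmul z u,
      mul_le_mul_of_nonneg_left h₂ hd]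
  have hwt_sq := pow_le_pow_left₀ (norm_nonneg _) hwt 2
  have hzs : γ * μ * ‖z - s‖ ^ 2 ≤ γ * μ * (‖t - s‖ + ‖z - t‖) ^ 2 := by
    gcongr
    linarith [norm_sub_le_norm_sub_add_norm_sub z t s]
  linarith [step_scalar_bound (a := ‖t - s‖) (mul_pos hγ hμ) hγμ hd hγδ hu]

/-- A real sequence with `0 < a 0` contracting by the factor `1 - m` falls below `ε` after
`(1 / m) * log (a 0 / ε)` steps. -/
lemma le_of_linear_contraction {a : ℕ → ℝ} {m ε : ℝ} (hm : 0 < m) (hm' : m ≤ 1) (ha : 0 < a 0)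
    (hstep : ∀ k, a (k + 1) ≤ (1 - m) * a k) (hε : 0 < ε) {K : ℕ}
    (hK : (1 / m) * Real.log (a 0 / ε) ≤ (K : ℝ)) : a K ≤ ε := by
  have hpow : ∀ k, a k ≤ (1 - m) ^ k * a 0 := fun k => by
    induction k with
    | zero => simp
    | succ k ih =>
      rw [pow_succ', mul_assoc]
      exact (hstep k).trans (mul_le_mul_of_nonneg_left ih (sub_nonneg.2 hm'))
  have hexp : (1 - m) ^ K ≤ Real.exp (-(K * m)) := by
    rw [← mul_neg, Real.exp_nat_mul]
    exact pow_le_pow_left₀ (sub_nonneg.2 hm') (Real.one_sub_le_exp_neg m) K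
  have hlog : Real.log (a 0 / ε) ≤ K * m := by
    rwa [one_div_mul_eq_div, div_le_iff₀ hm] at hK
  calc a K ≤ (1 - m) ^ K * a 0 := hpow K
    _ ≤ Real.exp (-Real.log (a 0 / ε)) * a 0 := by
      gcongr
      exact hexp.trans (Real.exp_le_exp.2 (neg_le_neg hlog))
    _ = ε := by
      rw [Real.exp_neg, Real.exp_log (div_pos ha hε)]
      field_simp

/-- Theorem 5 of the paper (Theorem 3 in the main text): the centralized algorithm
with stepsize `γ = min{1/(12μ), 1/(4δ)}` and relative subproblem accuracy `ẽ` reaches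
an ε-accurate solution after `K ≥ (1/(γμ))·ln(‖z⁰ − z*‖²/ε)` iterations. -/
theorem stmt_11 {H : Type*} [NormedAddCommGroup H] [InnerProductSpace ℝ H]
    (Z : Set H) (hZne : Z.Nonempty) (hZconv : Convex ℝ Z)
    (μ δ : ℝ) (hμ : 0 < μ) (hδ : 0 < δ)
    (F F₁ : H → H)
    (hmono : ∀ z₁ ∈ Z, ∀ z₂ ∈ Z, μ * ‖z₁ - z₂‖ ^ 2 ≤ ⟪F z₁ - F z₂, z₁ - z₂⟫)
    (hlip : ∀ z₁ z₂ : H, ‖(F z₁ - F₁ z₁) - (F z₂ - F₁ z₂)‖ ≤ δ * ‖z₁ - z₂‖)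
    (zstar : H) (hzstarZ : zstar ∈ Z)
    (hopt : ∀ ζ ∈ Z, 0 ≤ ⟪F zstar, ζ - zstar⟫)
    (γ etil : ℝ) (hγ : γ = min (1 / (12 * μ)) (1 / (4 * δ)))
    (hetil : etil = 1 / (2 * (2 + 4 * γ * δ ^ 2 / μ + 4 / (γ * μ) + 4 * γ ^ 2 * δ ^ 2)))
    (z v uhat u w : ℕ → H)
    (hz0 : z 0 ∈ Z)
    (hv : ∀ k : ℕ, v k = z k - γ • (F (z k) - F₁ (z k)))
    (huhatZ : ∀ k : ℕ, uhat k ∈ Z)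
    (huhat : ∀ k : ℕ, ∀ ζ ∈ Z, ⟪γ • F₁ (uhat k) + uhat k - v k, uhat k - ζ⟫ ≤ 0)
    (hu : ∀ k : ℕ, ‖u k - uhat k‖ ^ 2 ≤ etil * ‖z k - uhat k‖ ^ 2)
    (hw : ∀ k : ℕ, w k = u k + γ • (F (z k) - F₁ (z k) - F (u k) + F₁ (u k)))
    (hzZ : ∀ k : ℕ, z (k + 1) ∈ Z)
    (hproj : ∀ k : ℕ, ∀ ζ ∈ Z, ⟪w k - z (k + 1), ζ - z (k + 1)⟫ ≤ 0)
    (ε : ℝ) (hε0 : 0 < ε) (hε1 : ε ≤ ‖z 0 - zstar‖ ^ 2)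
    (K : ℕ) (hK : (1 / (γ * μ)) * Real.log (‖z 0 - zstar‖ ^ 2 / ε) ≤ (K : ℝ)) :
    ‖z K - zstar‖ ^ 2 ≤ ε := by
  have hγ0 : 0 < γ := by
    rw [hγ]
    positivity
  have hγμ : γ * μ ≤ 1 / 12 := by
    have h : γ ≤ 1 / (12 * μ) := hγ ▸ min_le_left _ _
    rw [le_div_iff₀ (by positivity)] at h
    linarith
  have hγδ : γ * δ ≤ 1 / 4 := by
    have h : γ ≤ 1 / (4 * δ) := hγ ▸ min_le_right _ _
    rw [le_div_iff₀ (by positivity)] at h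
    linarith
  have hacc : 8 * (1 + (γ * δ) ^ 2) * etil ≤ γ * μ := by
    have h : 4 * γ * δ ^ 2 / μ + 4 / (γ * μ) = 4 * (1 + (γ * δ) ^ 2) / (γ * μ) := by
      field_simp
      ring
    have hle : etil ≤ 1 / (2 * (4 * (1 + (γ * δ) ^ 2) / (γ * μ))) := by
      rw [hetil, ← h]
      apply one_div_le_one_div_of_le (by positivity)
      have : 0 ≤ 4 * γ ^ 2 * δ ^ 2 := by positivity
      linarith
    calc 8 * (1 + (γ * δ) ^ 2) * etil
        ≤ 8 * (1 + (γ * δ) ^ 2) * (1 / (2 * (4 * (1 + (γ * δ) ^ 2) / (γ * μ)))) := by gcongr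
      _ = γ * μ := by
        field_simp
        norm_num
  refine le_of_linear_contraction (a := fun k => ‖z k - zstar‖ ^ 2) (mul_pos hγ0 hμ)
    (by linarith) (hε0.trans_le hε1) (fun k => ?_) hε0 hK
  refine step_contraction (D := fun x => F x - F₁ x) (f := F (uhat k)) (t := uhat k) (u := u k)
    hγ0 hμ hδ hγμ hγδ hlip ?_ ?_ ?_ ?_
  · have h := hmono _ (huhatZ k) _ hzstarZ
    rw [inner_sub_left] at h
    linarith [hopt _ (huhatZ k)]
  · simpa [hv k] using huhat k zstar hzstarZ
  · have hpos : 0 ≤ 8 * (1 + (γ * δ) ^ 2) := by positivity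
    calc 8 * (1 + (γ * δ) ^ 2) * ‖u k - uhat k‖ ^ 2
        ≤ 8 * (1 + (γ * δ) ^ 2) * (etil * ‖z k - uhat k‖ ^ 2) :=
          mul_le_mul_of_nonneg_left (hu k) hpos
      _ = 8 * (1 + (γ * δ) ^ 2) * etil * ‖z k - uhat k‖ ^ 2 := by ring
      _ ≤ γ * μ * ‖z k - uhat k‖ ^ 2 := mul_le_mul_of_nonneg_right hacc (sq_nonneg _)
  · have h := hproj k zstar hzstarZ
    rw [hw k] at h
    simpa only [sub_sub_eq_add_sub, sub_add, sub_sub] using h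
end

section
/- Let H be a real inner product space and Z ⊆ H a nonempty convex set of diameter at most Ω. Let L, G ≥ 0, δ > 0, set γ = 1/(2δ), and let F, F₁ : H → H satisfy: ‖F z₁ − F z₂‖ ≤ L‖z₁ − z₂‖ and ‖F₁ z₁ − F₁ z₂‖ ≤ L‖z₁ − z₂‖ for all z₁, z₂ ∈ Z; ‖(F z₁ − F₁ z₁) − (F z₂ − F₁ z₂)‖ ≤ δ‖z₁ − z₂‖ for all z₁, z₂ ∈ Z; and there is z* ∈ Z with ‖F z*‖ ≤ G and ‖F₁ z*‖ ≤ G. Let e ≥ 0, K ≥ 1, z⁰ ∈ Z, and suppose for each k = 0, …, K−1: v^k = z^k − γ(F z^k − F₁ z^k); û^k ∈ Z with ⟨γ F₁ û^k + û^k − v^k, û^k − ζ⟩ ≤ 0 for all ζ ∈ Z; u^k ∈ Z with ‖u^k − û^k‖² ≤ e; w^k = u^k + γ(F z^k − F₁ z^k − F u^k + F₁ u^k); and z^{k+1} ∈ Z with ⟨w^k − z^{k+1}, ζ − z^{k+1}⟩ ≤ 0 for all ζ ∈ Z. Then for every z' ∈ Z: (1/K) ∑_{k=0}^{K−1} ⟨F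 u^k, u^k − z'⟩ ≤ δΩ²/K + (4LΩ + 3G + 2δΩ)·√e + 2δe. -/
open RealInnerProductSpace

/-- Nonexpansiveness of the projection towards a point of the set: if `y` is the projection of `w`
and `x` lies in the set, then `y` is at least as close to `x` as `w`. -/
theorem norm_sub_sq_le_of_inner_nonpos {H : Type*} [NormedAddCommGroup H] [InnerProductSpace ℝ H]
    {w y x : H} (h : ⟪w - y, x - y⟫ ≤ 0) : ‖y - x‖ ^ 2 ≤ ‖w - x‖ ^ 2 := by
  have hsplit : w - x = (w - y) - (x - y) := by abel
  rw [hsplit, norm_sub_sq_real (w - y) (x - y), norm_sub_rev y x]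
  nlinarith [sq_nonneg ‖w - y‖]

/-- The algebraic core of one inexact extragradient step with stepsize `1 / (2 * δ)`. Here `p` and
`q` are the displacements of the iterate from the comparison point and from the previous iterate,
`s` is its error as a solution of the subproblem, `a` and `b` are the values of the simple operator
at the exact and at the inexact solution, `c` is the value of the remainder operator at the
previous iterate, and `d` is the variation of the remainder operator. -/
theorem inner_le_of_inexact_step {H : Type*} [NormedAddCommGroup H] [InnerProductSpace ℝ H]
    {δ γ : ℝ} (hδ : 0 < δ) (hγ : γ = 1 / (2 * δ)) {p q s a b c d : H}
    (hopt : ⟪γ • a + (q - s) + γ • c, p - s⟫ ≤ 0) (hd : ‖d‖ ≤ δ * ‖q‖) :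
    ⟪c + b - d, p⟫ ≤ δ * (‖p - q‖ ^ 2 - ‖p + γ • d‖ ^ 2)
      + ⟪a + c, s⟫ + ⟪b - a, p⟫ + 2 * δ * ⟪s, p⟫ := by
  have hγδ : 2 * δ * γ = 1 := by rw [hγ]; field_simp
  have hopt' := mul_nonpos_of_nonneg_of_nonpos (by positivity : 0 ≤ 2 * δ) hopt
  have hexp : 2 * δ * ⟪γ • a + (q - s) + γ • c, p - s⟫ = ⟪a, p⟫ - ⟪a, s⟫ + ⟪c, p⟫ - ⟪c, s⟫
      + 2 * δ * (⟪q, p⟫ - ⟪q, s⟫ - ⟪s, p⟫ + ‖s‖ ^ 2) := by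
    simp only [inner_add_left, inner_sub_left, inner_sub_right, real_inner_smul_left,
      real_inner_self_eq_norm_sq]
    linear_combination (⟪a, p⟫ - ⟪a, s⟫ + ⟪c, p⟫ - ⟪c, s⟫) * hγδ
  have hpd : δ * ‖p + γ • d‖ ^ 2 = δ * ‖p‖ ^ 2 + ⟪d, p⟫ + δ * (γ * ‖d‖) ^ 2 := by
    rw [norm_add_sq_real, real_inner_smul_right, norm_smul, mul_pow, mul_pow, Real.norm_eq_abs,
      sq_abs, real_inner_comm d p]
    linear_combination ⟪d, p⟫ * hγδ
  have hsmall : γ * ‖d‖ ≤ ‖q‖ / 2 := by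
    rw [hγ, div_mul_eq_mul_div, one_mul, div_le_div_iff₀ (by positivity) two_pos]
    linarith
  have hsmall_sq : (γ * ‖d‖) ^ 2 ≤ (‖q‖ / 2) ^ 2 :=
    pow_le_pow_left₀ (by rw [hγ]; positivity) hsmall 2
  have hquad : 2 * ⟪q, s⟫ - 2 * ‖s‖ ^ 2 + (γ * ‖d‖) ^ 2 ≤ ‖q‖ ^ 2 := by
    nlinarith [real_inner_le_norm q s, sq_nonneg (3 * ‖q‖ - 4 * ‖s‖), sq_nonneg ‖s‖]
  have hquad' := mul_le_mul_of_nonneg_left hquad hδ.le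
  rw [hexp] at hopt'
  have hpq := norm_sub_sq_real p q
  rw [real_inner_comm q p] at hpq
  rw [mul_sub, hpd, hpq]
  simp only [inner_add_left, inner_sub_left]
  linarith

/-- Averaged-iterate bound of Theorem 6 of the paper: for the convex-concave
centralized algorithm with stepsize `γ = 1/(2δ)` and subproblem accuracy `e`,
`(1/K)∑ₖ⟨F uᵏ, uᵏ − z'⟩ ≤ δΩ²/K + (4LΩ + 3G + 2δΩ)√e + 2δe` for every `z' ∈ Z`. -/
theorem stmt_14 {H : Type*} [NormedAddCommGroup H] [InnerProductSpace ℝ H]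
    (Z : Set H) (hZne : Z.Nonempty) (hZconv : Convex ℝ Z)
    (Ω : ℝ) (hdiam : ∀ a ∈ Z, ∀ b ∈ Z, ‖a - b‖ ≤ Ω)
    (L G δ : ℝ) (hL : 0 ≤ L) (hG : 0 ≤ G) (hδ : 0 < δ)
    (γ : ℝ) (hγ : γ = 1 / (2 * δ))
    (F F₁ : H → H)
    (hFlip : ∀ z₁ ∈ Z, ∀ z₂ ∈ Z, ‖F z₁ - F z₂‖ ≤ L * ‖z₁ - z₂‖)
    (hF₁lip : ∀ z₁ ∈ Z, ∀ z₂ ∈ Z, ‖F₁ z₁ - F₁ z₂‖ ≤ L * ‖z₁ - z₂‖)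
    (hrel : ∀ z₁ ∈ Z, ∀ z₂ ∈ Z, ‖(F z₁ - F₁ z₁) - (F z₂ - F₁ z₂)‖ ≤ δ * ‖z₁ - z₂‖)
    (zstar : H) (hzstarZ : zstar ∈ Z) (hFG : ‖F zstar‖ ≤ G) (hF₁G : ‖F₁ zstar‖ ≤ G)
    (e : ℝ) (he : 0 ≤ e) (K : ℕ) (hK : 1 ≤ K)
    (z v uhat u w : ℕ → H)
    (hzZ : ∀ k : ℕ, k ≤ K → z k ∈ Z)
    (hv : ∀ k < K, v k = z k - γ • (F (z k) - F₁ (z k)))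
    (huhatZ : ∀ k < K, uhat k ∈ Z)
    (huhat : ∀ k < K, ∀ ζ ∈ Z, ⟪γ • F₁ (uhat k) + uhat k - v k, uhat k - ζ⟫ ≤ 0)
    (huZ : ∀ k < K, u k ∈ Z)
    (hu : ∀ k < K, ‖u k - uhat k‖ ^ 2 ≤ e)
    (hw : ∀ k < K, w k = u k + γ • (F (z k) - F₁ (z k) - F (u k) + F₁ (u k)))
    (hproj : ∀ k < K, ∀ ζ ∈ Z, ⟪w k - z (k + 1), ζ - z (k + 1)⟫ ≤ 0) :
    ∀ z' ∈ Z,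
      (1 / (K : ℝ)) * ∑ k ∈ Finset.range K, ⟪F (u k), u k - z'⟫ ≤
        δ * Ω ^ 2 / (K : ℝ) + (4 * L * Ω + 3 * G + 2 * δ * Ω) * Real.sqrt e
          + 2 * δ * e := by
  intro z' hz'
  have hΩ : 0 ≤ Ω := (norm_nonneg _).trans (hdiam z' hz' z' hz')
  have hsqrt := Real.sqrt_nonneg e
  set C := (3 * L * Ω + G + 2 * δ * Ω) * Real.sqrt e with hC
  have hstep : ∀ k ∈ Finset.range K, ⟪F (u k), u k - z'⟫ ≤
      δ * (‖z k - z'‖ ^ 2 - ‖z (k + 1) - z'‖ ^ 2) + C := by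
    intro k hk
    have hk : k < K := Finset.mem_range.mp hk
    have hz := hzZ k hk.le
    have hs : ‖u k - uhat k‖ ≤ Real.sqrt e := Real.le_sqrt_of_sq_le (hu k hk)
    have hp : ‖u k - z'‖ ≤ Ω := hdiam _ (huZ k hk) _ hz'
    have hopt : ⟪γ • F₁ (uhat k) + ((u k - z k) - (u k - uhat k)) + γ • (F (z k) - F₁ (z k)),
        (u k - z') - (u k - uhat k)⟫ ≤ 0 := by
      convert huhat k hk z' hz' using 2
      · rw [hv k hk]; abel
      · abel
    have hd : ‖(F (z k) - F₁ (z k)) - (F (u k) - F₁ (u k))‖ ≤ δ * ‖u k - z k‖ := by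
      rw [norm_sub_rev (u k)]
      exact hrel _ hz _ (huZ k hk)
    have hmain := inner_le_of_inexact_step (b := F₁ (u k)) hδ hγ hopt hd
    have hF : F (z k) - F₁ (z k) + F₁ (u k) - ((F (z k) - F₁ (z k)) - (F (u k) - F₁ (u k)))
        = F (u k) := by abel
    have hprev : (u k - z') - (u k - z k) = z k - z' := by abel
    have hnext : (u k - z') + γ • ((F (z k) - F₁ (z k)) - (F (u k) - F₁ (u k))) = w k - z' := by
      rw [hw k hk, sub_sub_eq_add_sub, sub_add_eq_add_sub]
      congr 3
      abel
    rw [hF, hprev, hnext] at hmain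
    have hclose := mul_le_mul_of_nonneg_left
      (norm_sub_sq_le_of_inner_nonpos (hproj k hk z' hz')) hδ.le
    have hgrad : ‖F₁ (uhat k) + (F (z k) - F₁ (z k))‖ ≤ 2 * L * Ω + G := by
      have hsplit : F₁ (uhat k) + (F (z k) - F₁ (z k)) =
          (F₁ (uhat k) - F₁ (z k)) + (F (z k) - F zstar) + F zstar := by abel
      rw [hsplit]
      have h₁ := (hF₁lip _ (huhatZ k hk) _ hz).trans
        (mul_le_mul_of_nonneg_left (hdiam _ (huhatZ k hk) _ hz) hL)
      have h₂ := (hFlip _ hz _ hzstarZ).trans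
        (mul_le_mul_of_nonneg_left (hdiam _ hz _ hzstarZ) hL)
      linarith [norm_add₃_le (a := F₁ (uhat k) - F₁ (z k)) (b := F (z k) - F zstar)
        (c := F zstar)]
    have herr₁ : ⟪F₁ (uhat k) + (F (z k) - F₁ (z k)), u k - uhat k⟫ ≤
        (2 * L * Ω + G) * Real.sqrt e :=
      (real_inner_le_norm _ _).trans (mul_le_mul hgrad hs (norm_nonneg _) (by positivity))
    have herr₂ : ⟪F₁ (u k) - F₁ (uhat k), u k - z'⟫ ≤ L * Real.sqrt e * Ω :=
      (real_inner_le_norm _ _).trans (mul_le_mul ((hF₁lip _ (huZ k hk) _ (huhatZ k hk)).trans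
        (mul_le_mul_of_nonneg_left hs hL)) hp (norm_nonneg _) (by positivity))
    have herr₃ : ⟪u k - uhat k, u k - z'⟫ ≤ Real.sqrt e * Ω :=
      (real_inner_le_norm _ _).trans (mul_le_mul hs hp (norm_nonneg _) hsqrt)
    have herr₃' := mul_le_mul_of_nonneg_left herr₃ (by positivity : 0 ≤ 2 * δ)
    rw [hC]
    linarith
  have hsum := Finset.sum_le_sum hstep
  rw [Finset.sum_add_distrib, ← Finset.mul_sum,
    Finset.sum_range_sub' (fun k => ‖z k - z'‖ ^ 2), Finset.sum_const, Finset.card_range,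
    nsmul_eq_mul] at hsum
  have hK' : (0 : ℝ) < K := by exact_mod_cast hK
  have hinit : ‖z 0 - z'‖ ^ 2 ≤ Ω ^ 2 :=
    pow_le_pow_left₀ (norm_nonneg _) (hdiam _ (hzZ 0 K.zero_le) _ hz') 2
  have htotal : ∑ k ∈ Finset.range K, ⟪F (u k), u k - z'⟫ ≤ δ * Ω ^ 2 + K * C := by
    nlinarith [sq_nonneg ‖z K - z'‖]
  have havg : (1 / (K : ℝ)) * ∑ k ∈ Finset.range K, ⟪F (u k), u k - z'⟫ ≤
      δ * Ω ^ 2 / K + C := by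
    calc _ ≤ (1 / (K : ℝ)) * (δ * Ω ^ 2 + K * C) :=
          mul_le_mul_of_nonneg_left htotal (by positivity)
      _ = _ := by field_simp
  have hslack : 0 ≤ (L * Ω + 2 * G) * Real.sqrt e := by positivity
  have hslack' : 0 ≤ 2 * δ * e := by positivity
  rw [hC] at havg
  linarith
end
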